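/- arXiv:2405.16614 — 2 statements merged into one kernel-verified Lean document; each statement's English description precedes it below -/
import Mathlib

section
/- Let 0 < β₊ < 1, 0 < β₋ < 1, α₊, α₋ > 0, λ₊, λ₋ > 0, μ ∈ ℝ. For every real y, μiy + ∫₀^∞ (e^{ivy} − 1)·α₊·(β₊ + λ₊v)·v^{−1−β₊}·e^{−λ₊v} dv + ∫₀^∞ (e^{−ivy} − 1)·α₋·(β₋ + λ₋v)·v^{−1−β₋}·e^{−λ₋v} dv = μiy + α₊·Γ(1−β₊)·(iy)/(λ₊ − iy)^{1−β₊} + α₋·Γ(1−β₋)·(−iy)/(λ₋ + iy)^{1−β₋}. -/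
open MeasureTheory Set

open Filter Topology ProbabilityTheory

lemma integrableOn_Ioi_rpow_mul_exp_neg_mul {s r : ℝ} (hs : -1 < s) (hr : 0 < r) :
    IntegrableOn (fun t : ℝ => t ^ s * Real.exp (-(r * t))) (Ioi 0) := by
  simpa using integrableOn_rpow_mul_exp_neg_mul_rpow hs one_pos hr

/-- The Laplace transform of `t ^ (a - 1)` on the open right half-plane. -/
lemma integral_Ioi_rpow_mul_cexp_neg_mul {a : ℝ} (ha : 0 < a) {z : ℂ} (hz : 0 < z.re) :
    ∫ t in Ioi (0 : ℝ), ((t ^ (a - 1) : ℝ) : ℂ) * Complex.exp (-(z * t)) =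
      Real.Gamma a / z ^ (a : ℂ) := by
  set ν : Measure ℝ :=
    (volume.restrict (Ioi 0)).withDensity (fun t => ENNReal.ofReal (t ^ (a - 1))) with hν
  have hm : Measurable fun t : ℝ => ENNReal.ofReal (t ^ (a - 1)) := by fun_prop
  have hexpSet : Ioi (0 : ℝ) ⊆ integrableExpSet (fun t : ℝ => -t) ν := by
    intro r hr
    change Integrable _ _
    rw [hν, integrable_withDensity_iff_integrable_smul' hm (by simp)]
    refine (integrableOn_Ioi_rpow_mul_exp_neg_mul (by linarith : -1 < a - 1) hr).congr_fun
      (fun t ht => ?_) measurableSet_Ioi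
    simp [ENNReal.toReal_ofReal (Real.rpow_nonneg (le_of_lt ht) _)]
  have hmgf (w : ℂ) : complexMGF (fun t : ℝ => -t) ν w =
      ∫ t in Ioi (0 : ℝ), ((t ^ (a - 1) : ℝ) : ℂ) * Complex.exp (-(w * t)) := by
    rw [complexMGF, hν, integral_withDensity_eq_integral_toReal_smul hm (by simp)]
    refine setIntegral_congr_fun measurableSet_Ioi fun t ht => ?_
    simp [ENNReal.toReal_ofReal (Real.rpow_nonneg (le_of_lt ht) _)]
  have hopen : IsOpen {w : ℂ | 0 < w.re} := isOpen_lt continuous_const Complex.continuous_re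
  have hF : AnalyticOnNhd ℂ (complexMGF (fun t : ℝ => -t) ν) {w : ℂ | 0 < w.re} :=
    analyticOnNhd_complexMGF.mono fun w hw => interior_maximal hexpSet isOpen_Ioi hw
  have hG : AnalyticOnNhd ℂ (fun w : ℂ => Real.Gamma a / w ^ (a : ℂ)) {w : ℂ | 0 < w.re} := by
    refine DifferentiableOn.analyticOnNhd (fun w hw => ?_) hopen
    have hw0 : w ≠ 0 := by rintro rfl; simp at hw
    have : DifferentiableAt ℂ (fun w : ℂ => w ^ (a : ℂ)) w :=
      differentiableAt_id.cpow_const (Or.inl hw)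
    exact ((differentiableAt_const _).div this
      (by simp [Complex.cpow_eq_zero_iff, hw0])).differentiableWithinAt
  have hreal (r : ℝ) (hr : 0 < r) :
      complexMGF (fun t : ℝ => -t) ν r = Real.Gamma a / (r : ℂ) ^ (a : ℂ) := by
    rw [hmgf, ← Complex.ofReal_cpow hr.le]
    have := Real.integral_rpow_mul_exp_neg_mul_Ioi ha hr
    rw [one_div, Real.inv_rpow hr.le] at this
    rw [← Complex.ofReal_div, div_eq_inv_mul, ← this, ← integral_complex_ofReal]
    simp
  have hfreq : ∃ᶠ w in 𝓝[≠] (1 : ℂ), complexMGF (fun t : ℝ => -t) ν w =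
      Real.Gamma a / w ^ (a : ℂ) := by
    have htend : Tendsto (fun r : ℝ => (r : ℂ)) (𝓝[>] 1) (𝓝[≠] (1 : ℂ)) := by
      refine tendsto_nhdsWithin_iff.2 ⟨?_, ?_⟩
      · exact (Complex.continuous_ofReal.tendsto' 1 1 (by simp)).mono_left nhdsWithin_le_nhds
      · filter_upwards [self_mem_nhdsWithin] with r hr
        simpa using (ne_of_gt hr : r ≠ 1)
    refine htend.frequently (Eventually.frequently ?_)
    filter_upwards [self_mem_nhdsWithin] with r hr
    exact hreal r (zero_lt_one.trans hr)
  rw [← hmgf]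
  exact hF.eqOn_of_preconnected_of_frequently_eq hG
    (convex_halfSpace_re_gt 0).isPreconnected (by simp) hfreq hz

/-- The one-sided Lévy–Khintchine integral of the tempered density
`α (β + lam v) v ^ (-1 - β) e ^ (-lam v)`. -/
lemma integral_Ioi_cexp_sub_one_mul_tempered {α β lam : ℝ} (hβ1 : β < 1) (hlam : 0 < lam)
    (y : ℝ) :
    ∫ v in Ioi (0 : ℝ), (Complex.exp (Complex.I * v * y) - 1) *
        ((α * (β + lam * v) * v ^ (-1 - β) * Real.exp (-lam * v) : ℝ) : ℂ) =
      (α : ℂ) * (Real.Gamma (1 - β) : ℂ) * (Complex.I * y) /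
        ((lam : ℂ) - Complex.I * y) ^ ((1 - β : ℝ) : ℂ) := by
  have hbound (v : ℝ) (hv : 0 < v) : ‖Complex.exp (Complex.I * v * y) - 1‖ ≤ |y| * v := by
    have := Real.norm_exp_I_mul_ofReal_sub_one_le (x := v * y)
    rwa [Complex.ofReal_mul, ← mul_assoc, Real.norm_eq_abs, abs_mul, abs_of_pos hv,
      mul_comm v] at this
  have hmul (v : ℝ) (hv : 0 < v) (s : ℝ) : v * v ^ s = v ^ (1 + s) := by
    rw [Real.rpow_add hv, Real.rpow_one]
  have hu (v : ℝ) (_ : v ∈ Ioi (0 : ℝ)) :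
      HasDerivAt (fun v : ℝ => Complex.exp (Complex.I * v * y) - 1)
        (Complex.I * y * Complex.exp (Complex.I * v * y)) v := by
    have h := ((((hasDerivAt_id (v : ℂ)).const_mul Complex.I).mul_const
      (y : ℂ)).cexp.sub_const 1).comp_ofReal
    convert! h using 1
    simp; ring
  have hw (v : ℝ) (hv : v ∈ Ioi (0 : ℝ)) :
      HasDerivAt (fun v : ℝ => ((-(α * (v ^ (-β) * Real.exp (-lam * v))) : ℝ) : ℂ))
        ((α * (β + lam * v) * v ^ (-1 - β) * Real.exp (-lam * v) : ℝ) : ℂ) v := by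
    refine HasDerivAt.ofReal_comp ?_
    have h := (((Real.hasDerivAt_rpow_const (p := -β) (Or.inl (ne_of_gt hv))).mul
      ((hasDerivAt_id v).const_mul (-lam)).exp).const_mul α).neg
    convert! h using 1
    have e : v ^ (-β) = v * v ^ (-1 - β) := by rw [hmul v hv]; ring_nf
    have e' : -β - 1 = -1 - β := by ring
    simp only [id, e, e']
    ring
  have hint := integrableOn_Ioi_rpow_mul_exp_neg_mul (by linarith : -1 < -β) hlam
  have hint' := integrableOn_Ioi_rpow_mul_exp_neg_mul (by linarith : -1 < 1 - β) hlam
  have huw' : IntegrableOn ((fun v : ℝ => Complex.exp (Complex.I * v * y) - 1) *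
      fun v : ℝ => ((α * (β + lam * v) * v ^ (-1 - β) * Real.exp (-lam * v) : ℝ) : ℂ))
      (Ioi 0) := by
    refine Integrable.mono' (((hint.const_mul |β|).add (hint'.const_mul lam)).const_mul
      (|y| * |α|)) (by fun_prop) ?_
    filter_upwards [ae_restrict_mem measurableSet_Ioi] with v hv
    have hv0 : 0 < v := hv
    have e1 : v ^ (-β) = v * v ^ (-1 - β) := by rw [hmul v hv]; ring_nf
    have e2 : v ^ (1 - β) = v * (v * v ^ (-1 - β)) := by
      rw [hmul v hv, hmul v hv]; ring_nf
    have h1 : |β + lam * v| ≤ |β| + lam * v := by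
      simpa [abs_of_pos (mul_pos hlam hv0)] using abs_add_le β (lam * v)
    have hp : 0 < v ^ (-1 - β) := Real.rpow_pos_of_pos hv0 _
    simp only [Pi.mul_apply, Pi.add_apply, norm_mul, Complex.norm_real, Real.norm_eq_abs,
      abs_of_pos hp, Real.abs_exp, e1, e2]
    calc _ ≤ (|y| * v) * (|α| * (|β| + lam * v) * v ^ (-1 - β) * Real.exp (-lam * v)) := by
          gcongr
          exact hbound v hv0
      _ = _ := by rw [neg_mul]; ring
  have hlap (v : ℝ) : Complex.exp (Complex.I * v * y) * ((Real.exp (-lam * v) : ℝ) : ℂ) =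
      Complex.exp (-((lam - Complex.I * y) * v)) := by
    rw [Complex.ofReal_exp, ← Complex.exp_add]
    congr 1
    push_cast
    ring
  have hu'w : IntegrableOn ((fun v : ℝ => Complex.I * y * Complex.exp (Complex.I * v * y)) *
      fun v : ℝ => ((-(α * (v ^ (-β) * Real.exp (-lam * v))) : ℝ) : ℂ)) (Ioi 0) := by
    refine Integrable.mono' (hint.const_mul (|y| * |α|)) (by fun_prop) ?_
    filter_upwards [ae_restrict_mem measurableSet_Ioi] with v hv
    have hn : ‖Complex.exp (Complex.I * v * y)‖ = 1 := by
      simp [Complex.norm_exp]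
    have hp : 0 < v ^ (-β) := Real.rpow_pos_of_pos hv _
    simp only [Pi.mul_apply, norm_mul, hn, Complex.norm_real, Real.norm_eq_abs, abs_neg, abs_mul,
      abs_of_pos hp, Real.abs_exp, Complex.norm_I, neg_mul]
    exact le_of_eq (by ring)
  have hnorm (v : ℝ) (hv : 0 < v) :
      ‖(Complex.exp (Complex.I * v * y) - 1) *
        ((-(α * (v ^ (-β) * Real.exp (-lam * v))) : ℝ) : ℂ)‖ ≤
      |y| * |α| * (v ^ (1 - β) * Real.exp (-lam * v)) := by
    have hp : 0 < v ^ (-β) := Real.rpow_pos_of_pos hv _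
    have e2 : v ^ (1 - β) = v * v ^ (-β) := by rw [hmul v hv]; ring_nf
    simp only [norm_mul, Complex.norm_real, Real.norm_eq_abs, abs_neg, abs_mul, abs_of_pos hp,
      Real.abs_exp, e2]
    calc _ ≤ (|y| * v) * (|α| * (v ^ (-β) * Real.exp (-lam * v))) := by
          gcongr
          exact hbound v hv
      _ = _ := by ring
  have h_zero : Tendsto ((fun v : ℝ => Complex.exp (Complex.I * v * y) - 1) *
      fun v : ℝ => ((-(α * (v ^ (-β) * Real.exp (-lam * v))) : ℝ) : ℂ)) (𝓝[>] 0) (𝓝 0) := by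
    have hlim : Tendsto (fun v : ℝ => |y| * |α| * (v ^ (1 - β) * Real.exp (-lam * v)))
        (𝓝[>] 0) (𝓝 0) := by
      have hc : Continuous fun v : ℝ => |y| * |α| * (v ^ (1 - β) * Real.exp (-lam * v)) := by
        have := Real.continuous_rpow_const (by linarith : 0 ≤ 1 - β)
        fun_prop
      refine (hc.tendsto' 0 0 ?_).mono_left nhdsWithin_le_nhds
      simp [Real.zero_rpow (by linarith : 1 - β ≠ 0)]
    refine squeeze_zero_norm' ?_ hlim
    filter_upwards [self_mem_nhdsWithin] with v hv using hnorm v hv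
  have h_infty : Tendsto ((fun v : ℝ => Complex.exp (Complex.I * v * y) - 1) *
      fun v : ℝ => ((-(α * (v ^ (-β) * Real.exp (-lam * v))) : ℝ) : ℂ)) atTop (𝓝 0) := by
    have hlim := (tendsto_rpow_mul_exp_neg_mul_atTop_nhds_zero (1 - β) lam hlam).const_mul
      (|y| * |α|)
    rw [mul_zero] at hlim
    refine squeeze_zero_norm' ?_ hlim
    filter_upwards [eventually_gt_atTop 0] with v hv using hnorm v hv
  rw [integral_Ioi_mul_deriv_eq_deriv_mul hu hw huw' hu'w h_zero h_infty]
  have hL := integral_Ioi_rpow_mul_cexp_neg_mul (by linarith : 0 < 1 - β)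
    (z := lam - Complex.I * y) (by simpa using hlam)
  have e : ∫ v in Ioi (0 : ℝ), Complex.I * y * Complex.exp (Complex.I * v * y) *
      ((-(α * (v ^ (-β) * Real.exp (-lam * v))) : ℝ) : ℂ) =
      -(α * (Complex.I * y)) * (Real.Gamma (1 - β) /
        ((lam : ℂ) - Complex.I * y) ^ ((1 - β : ℝ) : ℂ)) := by
    rw [← hL, ← integral_const_mul]
    congr 1 with v
    rw [← hlap, sub_sub_cancel_left]
    push_cast
    ring
  rw [e]
  ring

/-- Characteristic exponent of the background driving Lévy process of the GTS distribution:
`μiy + ∫₀^∞ (e^{ivy}−1) N₊(dv) + ∫₀^∞ (e^{−ivy}−1) N₋(dv)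
  = μiy + α₊ Γ(1−β₊) (iy)/(λ₊−iy)^{1−β₊} + α₋ Γ(1−β₋) (−iy)/(λ₋+iy)^{1−β₋}`. -/
theorem GTS_BDLP_char_exponent (βp βm αp αm lamp lamm μ : ℝ)
    (hβp0 : 0 < βp) (hβp1 : βp < 1) (hβm0 : 0 < βm) (hβm1 : βm < 1)
    (hαp : 0 < αp) (hαm : 0 < αm) (hlamp : 0 < lamp) (hlamm : 0 < lamm) (y : ℝ) :
    (μ : ℂ) * Complex.I * y
      + (∫ v in Ioi (0 : ℝ),
          (Complex.exp (Complex.I * v * y) - 1) *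
            ((αp * (βp + lamp * v) * v ^ (-1 - βp) * Real.exp (-lamp * v) : ℝ) : ℂ))
      + (∫ v in Ioi (0 : ℝ),
          (Complex.exp (-(Complex.I * v * y)) - 1) *
            ((αm * (βm + lamm * v) * v ^ (-1 - βm) * Real.exp (-lamm * v) : ℝ) : ℂ))
    = (μ : ℂ) * Complex.I * y
      + (αp : ℂ) * (Real.Gamma (1 - βp) : ℂ) * (Complex.I * y) /
          ((lamp : ℂ) - Complex.I * y) ^ ((1 - βp : ℝ) : ℂ)
      + (αm : ℂ) * (Real.Gamma (1 - βm) : ℂ) * (-(Complex.I * y)) /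
          ((lamm : ℂ) + Complex.I * y) ^ ((1 - βm : ℝ) : ℂ) := by
  have hp := integral_Ioi_cexp_sub_one_mul_tempered (α := αp) (β := βp) hβp1 hlamp y
  have hm := integral_Ioi_cexp_sub_one_mul_tempered (α := αm) (β := βm) hβm1 hlamm (-y)
  simp only [Complex.ofReal_neg (r := y), mul_neg, sub_neg_eq_add] at hm
  rw [hp, hm, mul_neg]
end

section
/- Let 0 < β < 1, α > 0, λ > 0, and let ξ ∈ ℝ. Then the function y ↦ (e^{iξy} − 1)·α·λ^β·Γ(−β, λy)/y is integrable on (0,∞), the function u ↦ ((λ − iξu)^β − λ^β)/u is integrable on (0,1), and ∫₀^∞ (e^{iξy} − 1)·α·λ^β·Γ(−β, λy)·y^{−1} dy = α·Γ(−β) · ∫₀^1 ( (λ − iξu)^β − λ^β )·u^{−1} du, where (λ − iξu)^β is the principal branch of the complex power. -/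
open MeasureTheory Set

/-- Upper incomplete gamma function `Γ(s,x) = ∫_x^∞ t^{s−1} e^{−t} dt`. -/
noncomputable def upperGamma (s x : ℝ) : ℝ := ∫ t in Ioi x, t ^ (s - 1) * Real.exp (-t)

open Filter Topology

/-- The integrand of the Gamma integral, rescaled by `b > 0`, is integrable. -/
lemma integrableOn_rpow_mul_exp_neg_mul_Ioi {s b : ℝ} (hs : -1 < s) (hb : 0 < b) :
    IntegrableOn (fun v : ℝ => v ^ s * Real.exp (-(b * v))) (Ioi 0) := by
  simpa using integrableOn_rpow_mul_exp_neg_mul_rpow hs one_pos hb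

lemma norm_ofReal_rpow_mul_cexp_neg_mul {s v : ℝ} (hv : 0 < v) (a : ℂ) :
    ‖((v ^ s : ℝ) : ℂ) * Complex.exp (-(a * v))‖ = v ^ s * Real.exp (-(a.re * v)) := by
  rw [norm_mul, Complex.norm_real, Complex.norm_exp, Real.norm_of_nonneg (by positivity)]
  simp

lemma integrableOn_ofReal_rpow_mul_cexp_neg_mul_Ioi {s : ℝ} (hs : -1 < s) {a : ℂ}
    (ha : 0 < a.re) :
    IntegrableOn (fun v : ℝ => ((v ^ s : ℝ) : ℂ) * Complex.exp (-(a * v))) (Ioi 0) := by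
  refine (integrableOn_rpow_mul_exp_neg_mul_Ioi hs ha).mono' (by fun_prop) ?_
  filter_upwards [ae_restrict_mem measurableSet_Ioi] with v hv
  exact (norm_ofReal_rpow_mul_cexp_neg_mul hv a).le

lemma differentiableAt_integral_ofReal_rpow_mul_cexp_neg_mul {s : ℝ} (hs : -1 < s) {a : ℂ}
    (ha : 0 < a.re) :
    DifferentiableAt ℂ
      (fun a : ℂ => ∫ v in Ioi (0 : ℝ), ((v ^ s : ℝ) : ℂ) * Complex.exp (-(a * v))) a := by
  have hopen : {z : ℂ | a.re / 2 < z.re} ∈ 𝓝 a :=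
    (isOpen_lt continuous_const Complex.continuous_re).mem_nhds (by simp; linarith)
  refine (hasDerivAt_integral_of_dominated_loc_of_deriv_le
    (μ := volume.restrict (Ioi 0))
    (F := fun (a : ℂ) (v : ℝ) => ((v ^ s : ℝ) : ℂ) * Complex.exp (-(a * v)))
    (F' := fun a v => ((v ^ s : ℝ) : ℂ) * (Complex.exp (-(a * v)) * -(v : ℂ)))
    (bound := fun v : ℝ => v ^ (s + 1) * Real.exp (-(a.re / 2 * v))) hopen
    (Eventually.of_forall fun z => by fun_prop)
    (integrableOn_ofReal_rpow_mul_cexp_neg_mul_Ioi hs ha) (by fun_prop) ?_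
    (integrableOn_rpow_mul_exp_neg_mul_Ioi (by linarith) (by linarith)) ?_).2.differentiableAt
  · filter_upwards [ae_restrict_mem measurableSet_Ioi] with v hv z hz
    have hv : 0 < v := hv
    have hz : a.re / 2 < z.re := hz
    rw [← mul_assoc, norm_mul, norm_ofReal_rpow_mul_cexp_neg_mul hv, norm_neg,
      Complex.norm_real, Real.norm_of_nonneg hv.le, Real.rpow_add_one hv.ne', mul_right_comm]
    gcongr
  · refine Eventually.of_forall fun v z _ => ?_
    have h : HasDerivAt (fun z : ℂ => -(z * v)) (-(v : ℂ)) z := by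
      simpa using! ((hasDerivAt_id z).mul_const (v : ℂ)).neg
    exact h.cexp.const_mul _

/-- The Laplace transform of `v ↦ v ^ (s - 1)` at a complex argument in the right half plane. -/
lemma integral_ofReal_rpow_mul_cexp_neg_mul_Ioi {s : ℝ} (hs : 0 < s) {a : ℂ} (ha : 0 < a.re) :
    ∫ v in Ioi (0 : ℝ), ((v ^ (s - 1) : ℝ) : ℂ) * Complex.exp (-(a * v)) =
      (Real.Gamma s : ℂ) * a ^ (-s : ℂ) := by
  set U : Set ℂ := {z | 0 < z.re}
  have hU : IsOpen U := isOpen_lt continuous_const Complex.continuous_re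
  have hdiff₁ : DifferentiableOn ℂ (fun a : ℂ =>
      ∫ v in Ioi (0 : ℝ), ((v ^ (s - 1) : ℝ) : ℂ) * Complex.exp (-(a * v))) U := fun z hz =>
    (differentiableAt_integral_ofReal_rpow_mul_cexp_neg_mul
      (by linarith) hz).differentiableWithinAt
  have hdiff₂ : DifferentiableOn ℂ (fun a : ℂ => (Real.Gamma s : ℂ) * a ^ (-s : ℂ)) U :=
    fun z hz => ((differentiableAt_id.cpow_const (Or.inl hz)).const_mul _).differentiableWithinAt
  have hreal : ∀ r : ℝ, 0 < r →
      ∫ v in Ioi (0 : ℝ), ((v ^ (s - 1) : ℝ) : ℂ) * Complex.exp (-((r : ℂ) * v)) =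
        (Real.Gamma s : ℂ) * (r : ℂ) ^ (-s : ℂ) := by
    intro r hr
    have h := congrArg (fun x : ℝ => (x : ℂ)) (Real.integral_rpow_mul_exp_neg_mul_Ioi hs hr)
    simp only [← integral_complex_ofReal] at h
    rw [one_div, Real.inv_rpow hr.le, ← Real.rpow_neg hr.le, mul_comm] at h
    push_cast [Complex.ofReal_cpow hr.le] at h ⊢
    exact h
  have hfreq : ∃ᶠ z : ℂ in 𝓝[≠] 1,
      ∫ v in Ioi (0 : ℝ), ((v ^ (s - 1) : ℝ) : ℂ) * Complex.exp (-(z * v)) =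
        (Real.Gamma s : ℂ) * z ^ (-s : ℂ) := by
    have hmap : Tendsto (fun r : ℝ => (r : ℂ)) (𝓝[≠] 1) (𝓝[≠] 1) := by
      refine tendsto_nhdsWithin_of_tendsto_nhds_of_eventually_within _ ?_ ?_
      · exact (Complex.continuous_ofReal.tendsto' 1 1 (by simp)).mono_left nhdsWithin_le_nhds
      · filter_upwards [self_mem_nhdsWithin] with r hr
        simpa using hr
    refine hmap.frequently (Eventually.frequently ?_)
    filter_upwards [nhdsWithin_le_nhds (lt_mem_nhds (zero_lt_one' ℝ))] with r hr
    exact hreal r hr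
  exact (hdiff₁.analyticOnNhd hU).eqOn_of_preconnected_of_frequently_eq
    (hdiff₂.analyticOnNhd hU) (convex_halfSpace_re_gt 0).isPreconnected (by simp [U]) hfreq ha

lemma norm_cexp_I_mul_sub_one_le (ξ y : ℝ) :
    ‖Complex.exp (Complex.I * ξ * y) - 1‖ ≤ |ξ| * |y| := by
  have h := Real.norm_exp_I_mul_ofReal_sub_one_le (x := ξ * y)
  rwa [Complex.ofReal_mul, ← mul_assoc, Real.norm_eq_abs, abs_mul] at h

lemma norm_cexp_sub_one_mul_rpow_exp_le (ξ s b : ℝ) {v : ℝ} (hv : 0 < v) :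
    ‖(Complex.exp (Complex.I * ξ * v) - 1) * ((v ^ (s - 1) * Real.exp (-(b * v)) : ℝ) : ℂ)‖ ≤
      |ξ| * (v ^ s * Real.exp (-(b * v))) := by
  rw [norm_mul, Complex.norm_real, Real.norm_of_nonneg (by positivity)]
  calc _ ≤ |ξ| * |v| * (v ^ (s - 1) * Real.exp (-(b * v))) := by
        gcongr
        exact norm_cexp_I_mul_sub_one_le ξ v
    _ = _ := by
        rw [abs_of_pos hv, Real.rpow_sub_one hv.ne']
        field_simp

lemma integrableOn_cexp_sub_one_mul_rpow_exp {s b : ℝ} (hs : -1 < s) (hb : 0 < b) (ξ : ℝ) :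
    IntegrableOn (fun v : ℝ => (Complex.exp (Complex.I * ξ * v) - 1) *
      ((v ^ (s - 1) * Real.exp (-(b * v)) : ℝ) : ℂ)) (Ioi 0) := by
  refine ((integrableOn_rpow_mul_exp_neg_mul_Ioi hs hb).const_mul |ξ|).mono' (by fun_prop) ?_
  filter_upwards [ae_restrict_mem measurableSet_Ioi] with v hv
  exact norm_cexp_sub_one_mul_rpow_exp_le ξ s b hv

/-- The characteristic exponent of the one-sided tempered stable law. -/
lemma integral_cexp_sub_one_mul_rpow_exp {β b : ℝ} (hβ0 : 0 < β) (hβ1 : β < 1) (hb : 0 < b)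
    (ξ : ℝ) :
    ∫ v in Ioi (0 : ℝ), (Complex.exp (Complex.I * ξ * v) - 1) *
        ((v ^ (-β - 1) * Real.exp (-(b * v)) : ℝ) : ℂ) =
      (Real.Gamma (-β) : ℂ) *
        (((b : ℂ) - Complex.I * ξ) ^ (β : ℂ) - (b : ℂ) ^ (β : ℂ)) := by
  set a : ℂ := (b : ℂ) - Complex.I * ξ with ha_def
  have ha : 0 < a.re := by simpa [a] using hb
  have hbre : 0 < (b : ℂ).re := by simpa using hb
  have ha0 : a ≠ 0 := fun h => by simp [h] at ha
  have hb0 : (b : ℂ) ≠ 0 := by exact_mod_cast hb.ne'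
  have hβc : (β : ℂ) ≠ 0 := by exact_mod_cast hβ0.ne'
  have hsplit : ∀ v : ℝ, (Complex.exp (Complex.I * ξ * v) - 1) * Complex.exp (-((b : ℂ) * v)) =
      Complex.exp (-(a * v)) - Complex.exp (-((b : ℂ) * v)) := by
    intro v
    rw [sub_mul, ← Complex.exp_add, one_mul, ha_def]
    ring_nf
  set f : ℝ → ℂ := fun v => Complex.exp (-(a * v)) - Complex.exp (-((b : ℂ) * v))
  set f' : ℝ → ℂ := fun v => b * Complex.exp (-((b : ℂ) * v)) - a * Complex.exp (-(a * v))
  set g : ℝ → ℂ := fun v => ((-β⁻¹ * v ^ (-β) : ℝ) : ℂ)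
  set g' : ℝ → ℂ := fun v => ((v ^ (-β - 1) : ℝ) : ℂ)
  have hexp : ∀ (c : ℂ) (v : ℝ),
      HasDerivAt (fun v : ℝ => Complex.exp (-(c * v))) (-(c * Complex.exp (-(c * v)))) v := by
    intro c v
    have h : HasDerivAt (fun v : ℝ => -(c * (v : ℂ))) (-c) v := by
      simpa using! ((Complex.ofRealCLM.hasDerivAt (x := v)).const_mul c).neg
    convert! h.cexp using 1
    ring
  have hf : ∀ v ∈ Ioi (0 : ℝ), HasDerivAt f (f' v) v := by
    intro v _
    convert! (hexp a v).sub (hexp b v) using 1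
    simp only [f']
    ring
  have hg : ∀ v ∈ Ioi (0 : ℝ), HasDerivAt g (g' v) v := by
    intro v hv
    have h := ((Real.hasDerivAt_rpow_const (p := -β) (Or.inl (ne_of_gt hv))).const_mul
      (-β⁻¹)).ofReal_comp
    convert! h using 1
    simp only [g']
    congr 1
    field_simp
  have hfg' : ∀ v : ℝ, (Complex.exp (Complex.I * ξ * v) - 1) *
      ((v ^ (-β - 1) * Real.exp (-(b * v)) : ℝ) : ℂ) = f v * g' v := by
    intro v
    simp only [f, g', ← hsplit]
    push_cast
    ring
  have hint₁ : IntegrableOn (f * g') (Ioi 0) := by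
    refine (integrableOn_cexp_sub_one_mul_rpow_exp (s := -β) (by linarith) hb ξ).congr_fun
      (fun v _ => hfg' v) measurableSet_Ioi
  have hf'g : ∀ v : ℝ, f' v * g v =
      (a / β) * (((v ^ ((1 - β) - 1) : ℝ) : ℂ) * Complex.exp (-(a * v))) -
      (b / β) * (((v ^ ((1 - β) - 1) : ℝ) : ℂ) * Complex.exp (-((b : ℂ) * v))) := by
    intro v
    simp only [f', g]
    rw [show 1 - β - 1 = -β by ring]
    push_cast
    ring
  have hia := (integrableOn_ofReal_rpow_mul_cexp_neg_mul_Ioi (s := (1 - β) - 1) (by linarith)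
    ha).const_mul (a / β)
  have hib := (integrableOn_ofReal_rpow_mul_cexp_neg_mul_Ioi (s := (1 - β) - 1) (by linarith)
    hbre).const_mul ((b : ℂ) / β)
  have hint₂ : IntegrableOn (f' * g) (Ioi 0) :=
    IntegrableOn.congr_fun (hia.sub hib) (fun v _ => (hf'g v).symm) measurableSet_Ioi
  have hbound : ∀ v ∈ Ioi (0 : ℝ), ‖(f * g) v‖ ≤
      β⁻¹ * |ξ| * (v ^ (1 - β) * Real.exp (-(b * v))) := by
    intro v hv
    have hv : 0 < v := hv
    have h := norm_cexp_sub_one_mul_rpow_exp_le ξ (1 - β) b hv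
    have heq : (f * g) v = (-β⁻¹ : ℂ) * ((Complex.exp (Complex.I * ξ * v) - 1) *
        ((v ^ (1 - β - 1) * Real.exp (-(b * v)) : ℝ) : ℂ)) := by
      rw [show 1 - β - 1 = -β by ring]
      simp only [Pi.mul_apply, f, g, ← hsplit]
      push_cast
      ring
    rw [heq, norm_mul, norm_neg, Complex.norm_real,
      Real.norm_of_nonneg (inv_nonneg.mpr hβ0.le), mul_assoc β⁻¹]
    gcongr
  have hzero : Tendsto (f * g) (𝓝[>] 0) (𝓝 0) := by
    refine squeeze_zero_norm' (eventually_mem_nhdsWithin.mono hbound) ?_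
    have h : ContinuousAt
        (fun v : ℝ => β⁻¹ * |ξ| * (v ^ (1 - β) * Real.exp (-(b * v)))) 0 :=
      ((Real.continuousAt_rpow_const 0 (1 - β) (Or.inr (by linarith))).mul
        (by fun_prop)).const_mul _
    have h0 := h.tendsto
    rw [Real.zero_rpow (by linarith), zero_mul, mul_zero] at h0
    exact h0.mono_left nhdsWithin_le_nhds
  have hinfty : Tendsto (f * g) atTop (𝓝 0) := by
    refine squeeze_zero_norm' ((eventually_gt_atTop 0).mono hbound) ?_
    simpa using (tendsto_rpow_mul_exp_neg_mul_atTop_nhds_zero (1 - β) b hb).const_mul (β⁻¹ * |ξ|)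
  have hΓ : Real.Gamma (1 - β) = -β * Real.Gamma (-β) := by
    rw [← Real.Gamma_add_one (neg_ne_zero.mpr hβ0.ne')]
    ring_nf
  have hpow : ∀ c : ℂ, c ≠ 0 → c * c ^ (-((1 - β : ℝ) : ℂ)) = c ^ (β : ℂ) := by
    intro c hc
    have h := Complex.cpow_add (-((1 - β : ℝ) : ℂ)) 1 hc
    rw [Complex.cpow_one] at h
    rw [mul_comm, ← h]
    push_cast
    ring_nf
  simp_rw [hfg']
  rw [integral_Ioi_mul_deriv_eq_deriv_mul hf hg hint₁ hint₂ hzero hinfty]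
  simp_rw [hf'g]
  rw [integral_sub hia hib, integral_const_mul, integral_const_mul,
    integral_ofReal_rpow_mul_cexp_neg_mul_Ioi (by linarith) ha,
    integral_ofReal_rpow_mul_cexp_neg_mul_Ioi (by linarith) hbre, ← hpow a ha0, ← hpow b hb0, hΓ]
  push_cast
  field_simp
  ring

/-- The upper incomplete Gamma function as an integral over the unit interval. -/
lemma upperGamma_eq_integral_Ioc (s : ℝ) {x : ℝ} (hx : 0 < x) :
    upperGamma s x = ∫ u in Ioc (0 : ℝ) 1, x ^ s * u ^ (-s - 1) * Real.exp (-(x / u)) := by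
  have himage : (fun u => x / u) '' Ioo (0 : ℝ) 1 = Ioi x := by
    ext t
    constructor
    · rintro ⟨u, ⟨hu0, hu1⟩, rfl⟩
      exact (lt_div_iff₀ hu0).mpr (by nlinarith)
    · intro ht
      have ht : x < t := ht
      have ht0 : 0 < t := hx.trans ht
      exact ⟨x / t, ⟨by positivity, (div_lt_one ht0).mpr ht⟩, by field_simp⟩
  have hderiv : ∀ u ∈ Ioo (0 : ℝ) 1,
      HasDerivWithinAt (fun u => x / u) (-x / u ^ 2) (Ioo 0 1) u := by
    intro u hu
    have h := ((hasDerivAt_inv hu.1.ne').const_mul x).hasDerivWithinAt (s := Ioo 0 1)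
    convert! h using 1
    field_simp
  have hinj : InjOn (fun u => x / u) (Ioo (0 : ℝ) 1) := by
    intro u hu w hw h
    exact inv_injective (mul_left_cancel₀ hx.ne' (by simpa only [div_eq_mul_inv] using h))
  rw [upperGamma, ← himage, integral_image_eq_integral_abs_deriv_smul measurableSet_Ioo hderiv
    hinj, integral_Ioc_eq_integral_Ioo]
  refine setIntegral_congr_fun measurableSet_Ioo fun u hu => ?_
  have hu : 0 < u := hu.1
  simp only [smul_eq_mul]
  rw [abs_div, abs_neg, abs_of_pos hx, abs_of_pos (by positivity : 0 < u ^ 2),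
    Real.div_rpow hx.le hu.le, Real.rpow_sub_one hx.ne', Real.rpow_sub_one hu.ne',
    Real.rpow_sub_one hu.ne', Real.rpow_neg hu.le]
  field_simp

lemma ofReal_div_cpow {z : ℂ} (hz : z ≠ 0) {u : ℝ} (hu : 0 < u) (r : ℂ) :
    (z / u) ^ r = z ^ r * (u : ℂ) ^ (-r) := by
  have hu' : (u : ℂ) ≠ 0 := by exact_mod_cast hu.ne'
  rw [Complex.cpow_def_of_ne_zero (div_ne_zero hz hu'), Complex.cpow_def_of_ne_zero hz,
    Complex.cpow_def_of_ne_zero hu', ← Complex.exp_add, div_eq_inv_mul, ← Complex.ofReal_inv,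
    Complex.log_ofReal_mul (inv_pos.mpr hu) hz, Real.log_inv, Complex.ofReal_neg,
    Complex.ofReal_log hu.le]
  ring_nf

/-- The kernel whose two iterated integrals are the two sides of
`selfdecomposable_char_exponent`. -/
noncomputable def charExponentKernel (β lam ξ y u : ℝ) : ℂ :=
  (Complex.exp (Complex.I * ξ * y) - 1) *
    ((y ^ (-β - 1) * Real.exp (-(lam / u * y)) : ℝ) : ℂ) * ((u ^ (β - 1) : ℝ) : ℂ)

lemma integrable_charExponentKernel {β lam : ℝ} (hβ0 : 0 < β) (hβ1 : β < 1) (hlam : 0 < lam)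
    (ξ : ℝ) :
    Integrable (Function.uncurry (charExponentKernel β lam ξ))
      ((volume.restrict (Ioi 0)).prod (volume.restrict (Ioc 0 1))) := by
  have hy := (integrableOn_rpow_mul_exp_neg_mul_Ioi (s := -β) (by linarith) hlam).const_mul |ξ|
  have hu : IntegrableOn (fun u : ℝ => u ^ (β - 1)) (Ioc 0 1) :=
    (intervalIntegral.intervalIntegrable_rpow' (by linarith)).1
  refine (hy.mul_prod hu).mono' ?_ ?_
  · refine Measurable.aestronglyMeasurable ?_
    simp only [Function.uncurry_def, charExponentKernel]
    fun_prop
  · rw [Measure.prod_restrict]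
    filter_upwards [ae_restrict_mem (measurableSet_Ioi.prod measurableSet_Ioc)]
    rintro ⟨y, u⟩ ⟨hy, hu0, hu1⟩
    have hy : 0 < y := hy
    have hu0 : 0 < u := hu0
    have hu1 : u ≤ 1 := hu1
    simp only [Function.uncurry_apply_pair, charExponentKernel]
    rw [norm_mul, Complex.norm_real, Real.norm_of_nonneg (Real.rpow_nonneg hu0.le _)]
    gcongr
    refine (norm_cexp_sub_one_mul_rpow_exp_le ξ (-β) (lam / u) hy).trans ?_
    gcongr
    exact (le_div_iff₀ hu0).mpr (by nlinarith)

lemma integral_charExponentKernel_right {β lam : ℝ} (hlam : 0 < lam) (ξ : ℝ) {y : ℝ}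
    (hy : 0 < y) :
    ∫ u in Ioc (0 : ℝ) 1, charExponentKernel β lam ξ y u =
      (Complex.exp (Complex.I * ξ * y) - 1) *
        ((lam ^ β * upperGamma (-β) (lam * y) / y : ℝ) : ℂ) := by
  have h : lam ^ β * upperGamma (-β) (lam * y) / y =
      ∫ u in Ioc (0 : ℝ) 1, y ^ (-β - 1) * Real.exp (-(lam / u * y)) * u ^ (β - 1) := by
    rw [upperGamma_eq_integral_Ioc _ (mul_pos hlam hy), mul_div_right_comm,
      ← integral_const_mul]
    congr 1 with u
    rw [Real.mul_rpow hlam.le hy.le, Real.rpow_neg hlam.le, Real.rpow_sub_one hy.ne', neg_neg,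
      mul_div_right_comm]
    have := (Real.rpow_pos_of_pos hlam β).ne'
    field_simp
  rw [h, ← integral_complex_ofReal, ← integral_const_mul]
  simp only [charExponentKernel, Complex.ofReal_mul, mul_assoc]

lemma integral_charExponentKernel_left {β lam : ℝ} (hβ0 : 0 < β) (hβ1 : β < 1) (hlam : 0 < lam)
    (ξ : ℝ) {u : ℝ} (hu : 0 < u) :
    ∫ y in Ioi (0 : ℝ), charExponentKernel β lam ξ y u =
      (Real.Gamma (-β) : ℂ) *
        ((((lam : ℂ) - Complex.I * ξ * u) ^ (β : ℂ) - (lam : ℂ) ^ (β : ℂ)) / (u : ℂ)) := by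
  have hu' : (u : ℂ) ≠ 0 := by exact_mod_cast hu.ne'
  have hlam' : (lam : ℂ) ≠ 0 := by exact_mod_cast hlam.ne'
  have hz : (lam : ℂ) - Complex.I * ξ * u ≠ 0 := fun h => by
    have := congrArg Complex.re h
    simp at this
    exact hlam.ne' this
  have hdiv : ((lam / u : ℝ) : ℂ) - Complex.I * ξ = ((lam : ℂ) - Complex.I * ξ * u) / u := by
    push_cast
    field_simp
  simp only [charExponentKernel]
  rw [integral_mul_const, integral_cexp_sub_one_mul_rpow_exp hβ0 hβ1 (div_pos hlam hu), hdiv,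
    Complex.ofReal_div, ofReal_div_cpow hz hu, ofReal_div_cpow hlam' hu,
    Complex.ofReal_cpow hu.le, Complex.ofReal_sub, Complex.ofReal_one, Complex.cpow_sub _ _ hu',
    Complex.cpow_one, Complex.cpow_neg]
  have : (u : ℂ) ^ (β : ℂ) ≠ 0 := by simp [Complex.cpow_eq_zero_iff, hu']
  field_simp

/-- Characteristic exponent of the self-decomposable random variable whose background
driving Lévy process is the one-sided tempered stable process:
`∫₀^∞ (e^{iξy} − 1) α λ^β Γ(−β,λy) y⁻¹ dy = α Γ(−β) ∫₀^1 ((λ − iξu)^β − λ^β) u⁻¹ du`. -/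
theorem selfdecomposable_char_exponent (β α lam ξ : ℝ) (hβ0 : 0 < β) (hβ1 : β < 1)
    (hα : 0 < α) (hlam : 0 < lam) :
    IntegrableOn (fun y : ℝ =>
        (Complex.exp (Complex.I * ξ * y) - 1) *
          ((α * lam ^ β * upperGamma (-β) (lam * y) / y : ℝ) : ℂ)) (Ioi 0) ∧
    IntegrableOn (fun u : ℝ =>
        (((lam : ℂ) - Complex.I * ξ * u) ^ (β : ℂ) - (lam : ℂ) ^ (β : ℂ)) / (u : ℂ))
      (Ioc 0 1) ∧
    ∫ y in Ioi (0 : ℝ),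
        (Complex.exp (Complex.I * ξ * y) - 1) *
          ((α * lam ^ β * upperGamma (-β) (lam * y) / y : ℝ) : ℂ)
      = (α : ℂ) * (Real.Gamma (-β) : ℂ) *
          ∫ u in Ioc (0 : ℝ) 1,
            (((lam : ℂ) - Complex.I * ξ * u) ^ (β : ℂ) - (lam : ℂ) ^ (β : ℂ)) / (u : ℂ) := by
  have hK := integrable_charExponentKernel hβ0 hβ1 hlam ξ
  have hleft : ∀ y ∈ Ioi (0 : ℝ), (α : ℂ) * ∫ u in Ioc (0 : ℝ) 1, charExponentKernel β lam ξ y u =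
      (Complex.exp (Complex.I * ξ * y) - 1) *
        ((α * lam ^ β * upperGamma (-β) (lam * y) / y : ℝ) : ℂ) := by
    intro y hy
    rw [integral_charExponentKernel_right hlam ξ hy]
    push_cast
    ring
  have hΓ : (Real.Gamma (-β) : ℂ) ≠ 0 := by
    refine Complex.ofReal_ne_zero.mpr (Real.Gamma_ne_zero fun m hm => ?_)
    have hm : (m : ℝ) = β := by linarith
    have h0 : 0 < m := by exact_mod_cast hm ▸ hβ0
    have h1 : m < 1 := by exact_mod_cast hm ▸ hβ1
    omega
  refine ⟨?_, ?_, ?_⟩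
  · exact IntegrableOn.congr_fun (hK.integral_prod_left.const_mul (α : ℂ)) hleft measurableSet_Ioi
  · refine IntegrableOn.congr_fun (hK.integral_prod_right.const_mul (Real.Gamma (-β) : ℂ)⁻¹)
      (fun u hu => ?_) measurableSet_Ioc
    simp only [Function.uncurry_apply_pair]
    rw [integral_charExponentKernel_left hβ0 hβ1 hlam ξ hu.1, inv_mul_cancel_left₀ hΓ]
  · rw [← setIntegral_congr_fun measurableSet_Ioi hleft, integral_const_mul,
      integral_integral_swap hK, mul_assoc, ← integral_const_mul (Real.Gamma (-β) : ℂ)]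
    congr 1
    exact setIntegral_congr_fun measurableSet_Ioc fun u hu =>
      integral_charExponentKernel_left hβ0 hβ1 hlam ξ hu.1
end
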